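/- Let R be a commutative ring, M an R-module, and X a finite simplicial complex. Suppose given for each face σ of X a multiplicative subset S_σ ⊆ R such that S_τ ⊆ S_σ whenever τ ⊆ σ. Then the cohomology of the adelic (flag) cochain complex, whose s-cochains are C^s_ad = ∏_{σ0 ⊋ σ1 ⊋ ⋯ ⊋ σs} S_{σ0}^{-1}M (product over all strictly decreasing chains of faces of X) with differential the alternating sum of the maps deleting one face of the chain (using the localization maps S_{σ_i}^{-1}M → S_{σ_0}^{-1}M as needed), is isomorphic to the simplicial cohomology of X with coefficients in the dual system σ ↦ S_σ^{-1}M, i.e. the cohomology of the complex whose s-cochains are ∏_{σ an s-dimensional face of X} S_σ^{-1}M with simplicial coboundary δf(σ) = Σ_i (−1)^i (image of f(∂_i σ) under the localization map S_{∂_i σ}^{-1}M → S_σ^{-1}M). -/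

import Mathlib

section AdelicSimplicial

variable {R : Type} [CommRing R] (M : Type) [AddCommGroup M] [Module R M]
variable {V : Type} [LinearOrder V] (K : Set (Finset V))

/-- The faces of the simplicial complex `K`. -/
def Face : Type := {σ : Finset V // σ ∈ K}

variable (S : Face K → Submonoid R)

/-- The canonical localization map `S⁻¹M → T⁻¹M` for `S ≤ T`. -/
noncomputable def locMapOfLE {S T : Submonoid R} (h : S ≤ T) :
    LocalizedModule S M →ₗ[R] LocalizedModule T M :=
  LocalizedModule.liftOfLE S T h

/-- The module of simplicial `s`-cochains of `K` with coefficients in the dual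
system `σ ↦ S_σ⁻¹M`. -/
abbrev SimpCochain (s : ℕ) : Type :=
  ∀ σ : {σ : Face K // σ.1.card = s + 1}, LocalizedModule (S σ.1) M

/-- The simplicial coboundary `δf(σ) = Σᵢ (-1)ⁱ (image of f(∂ᵢσ) in S_σ⁻¹M)`. -/
noncomputable def simpCoboundary
    (hdown : ∀ σ ∈ K, ∀ τ, τ ⊆ σ → τ.Nonempty → τ ∈ K)
    (hmono : ∀ {τ σ : Face K}, τ.1 ⊆ σ.1 → S τ ≤ S σ) (s : ℕ) :
    SimpCochain M K S s →ₗ[R] SimpCochain M K S (s + 1) :=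
  LinearMap.pi fun σ =>
    ∑ i : Fin (s + 2),
      ((-1 : ℤ) ^ (i : ℕ)) •
        ((locMapOfLE M (hmono (Finset.erase_subset _ _))) ∘ₗ
          LinearMap.proj
            (⟨⟨σ.1.1.erase (σ.1.1.orderIsoOfFin σ.2 i).1,
                hdown σ.1.1 σ.1.2 _ (Finset.erase_subset _ _)
                  (Finset.card_pos.mp (by
                    rw [Finset.card_erase_of_mem (σ.1.1.orderIsoOfFin σ.2 i).2, σ.2]
                    omega))⟩,
              by
                rw [Finset.card_erase_of_mem (σ.1.1.orderIsoOfFin σ.2 i).2, σ.2]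
                omega⟩ :
              {τ : Face K // τ.1.card = s + 1}))

/-- `s`-simplices of the order (flag) complex of `K`: strictly decreasing chains
`σ₀ ⊋ σ₁ ⊋ ⋯ ⊋ σₛ` of faces of `K`. -/
def FlagSimplex (s : ℕ) : Type :=
  {c : Fin (s + 1) → Face K // StrictAnti fun i => (c i).1}

/-- The module of adelic (flag) `s`-cochains: the product over all strictly
decreasing chains `σ₀ ⊋ ⋯ ⊋ σₛ` of faces of `K` of `S_{σ₀}⁻¹M`. -/
abbrev AdelicCochain (s : ℕ) : Type :=
  ∀ c : FlagSimplex K s, LocalizedModule (S (c.1 0)) M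

/-- The adelic coboundary: the alternating sum of the maps deleting one face of the
chain, using the localization maps `S_{σ₁}⁻¹M → S_{σ₀}⁻¹M` as needed. -/
noncomputable def adelicCoboundary
    (hmono : ∀ {τ σ : Face K}, τ.1 ⊆ σ.1 → S τ ≤ S σ) (s : ℕ) :
    AdelicCochain M K S s →ₗ[R] AdelicCochain M K S (s + 1) :=
  LinearMap.pi fun c =>
    ∑ i : Fin (s + 2),
      ((-1 : ℤ) ^ (i : ℕ)) •
        ((locMapOfLE M (hmono (c.2.antitone (Fin.zero_le _) :
            (c.1 (Fin.succAbove i 0)).1 ≤ (c.1 0).1))) ∘ₗ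
          LinearMap.proj
            (⟨fun j => c.1 (Fin.succAbove i j),
              c.2.comp_strictMono (Fin.strictMono_succAbove i)⟩ : FlagSimplex K s))

end AdelicSimplicial

section TupleComplex

variable (T : Type*)

/-- The boundary map of the augmented chain complex of all finite tuples of `T`. -/
noncomputable def tupleBoundary (n : ℕ) :
    ((Fin (n + 1) → T) →₀ ℤ) →ₗ[ℤ] ((Fin n → T) →₀ ℤ) :=
  Finsupp.linearCombination ℤ fun c =>
    ∑ i : Fin (n + 1), (-1 : ℤ) ^ (i : ℕ) • Finsupp.single (fun j => c (i.succAbove j)) 1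

variable {T}

lemma tupleBoundary_single {n : ℕ} (c : Fin (n + 1) → T) :
    tupleBoundary T n (Finsupp.single c 1) =
      ∑ i : Fin (n + 1),
        (-1 : ℤ) ^ (i : ℕ) • Finsupp.single (fun j => c (i.succAbove j)) 1 := by
  simp [tupleBoundary]

lemma Fin.cons_succ_succAbove {n : ℕ} (v : T) (c : Fin (n + 1) → T) (i : Fin (n + 1)) :
    (fun j => (Fin.cons v c : Fin (n + 2) → T) (i.succ.succAbove j)) =
      Fin.cons v fun j => c (i.succAbove j) := by
  funext j
  refine Fin.cases ?_ (fun k => ?_) j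
  · simp
  · simp [Fin.succ_succAbove_succ]

lemma tupleBoundary_cone {n : ℕ} (v : T) (x : (Fin (n + 1) → T) →₀ ℤ) :
    tupleBoundary T (n + 1) (Finsupp.lmapDomain ℤ ℤ (Fin.cons v) x) =
      x - Finsupp.lmapDomain ℤ ℤ (Fin.cons v) (tupleBoundary T n x) := by
  induction x using Finsupp.induction_linear with
  | zero => simp
  | add x y hx hy => simp only [map_add, hx, hy]; abel
  | single c a =>
    rw [← mul_one a, ← smul_eq_mul, ← Finsupp.smul_single]
    simp only [map_smul, ← smul_sub]
    congr 1
    rw [Finsupp.lmapDomain_apply, Finsupp.mapDomain_single, tupleBoundary_single,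
      tupleBoundary_single, Fin.sum_univ_succ]
    simp only [Fin.cons_succ_succAbove, map_sum, map_smul, Finsupp.lmapDomain_apply,
      Finsupp.mapDomain_single, Fin.val_succ, pow_succ, mul_neg, mul_one, neg_smul,
      Finset.sum_neg_distrib, sub_eq_add_neg]
    simp

lemma tupleBoundary_tupleBoundary (n : ℕ) (x : (Fin (n + 2) → T) →₀ ℤ) :
    tupleBoundary T n (tupleBoundary T (n + 1) x) = 0 := by
  induction n with
  | zero =>
    induction x using Finsupp.induction_linear with
    | zero => simp
    | add x y hx hy => simp only [map_add, hx, hy, add_zero]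
    | single c a =>
      rw [← mul_one a, ← smul_eq_mul, ← Finsupp.smul_single]
      simp only [map_smul, tupleBoundary_single, Fin.sum_univ_succ, map_add]
      simp [Subsingleton.elim (fun j : Fin 0 => _) (Fin.elim0 : Fin 0 → T)]
  | succ n ih =>
    induction x using Finsupp.induction_linear with
    | zero => simp
    | add x y hx hy => simp only [map_add, hx, hy, add_zero]
    | single c a =>
      have hc : Finsupp.single c a =
          Finsupp.lmapDomain ℤ ℤ (Fin.cons (c 0)) (Finsupp.single (Fin.tail c) a) := by
        simp
      rw [hc, tupleBoundary_cone, map_sub, tupleBoundary_cone, ih]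
      simp

end TupleComplex

/-- A semi-simplicial family of cells, each determined by its tuple of vertices and lying under an
element `top` of a preorder `P`, such that the cells under each `p : P` form a cone. -/
structure CellFamily (P T : Type*) [Preorder P] where
  cell : ℕ → Type*
  vert : ∀ {n}, cell n → Fin (n + 1) → T
  vert_injective : ∀ n, Function.Injective (vert (n := n))
  face : ∀ {n}, Fin (n + 2) → cell (n + 1) → cell n
  vert_face : ∀ {n} (i : Fin (n + 2)) (c : cell (n + 1)),
    vert (face i c) = fun j => vert c (i.succAbove j)
  top : ∀ {n}, cell n → P
  top_face : ∀ {n} (i : Fin (n + 2)) (c : cell (n + 1)), top (face i c) ≤ top c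
  vert_zero_ne_one : ∀ {n} (c : cell (n + 1)), vert c 0 ≠ vert c 1
  apex : P → T
  exists_apex : ∀ p, ∃ c : cell 0, vert c 0 = apex p ∧ top c ≤ p
  exists_cone : ∀ p {n} (c : cell n), top c ≤ p → vert c 0 ≠ apex p →
    ∃ c' : cell (n + 1), vert c' = Fin.cons (apex p) (vert c) ∧ top c' ≤ p

namespace CellFamily

variable {P T : Type*} [Preorder P]

section Chains

variable (X : CellFamily P T)

/-- The integral `n`-chains. -/
abbrev Chain (n : ℕ) : Type _ := X.cell n →₀ ℤ

/-- The boundary map, the alternating sum of the faces. -/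
noncomputable def boundary (n : ℕ) : X.Chain (n + 1) →ₗ[ℤ] X.Chain n :=
  Finsupp.linearCombination ℤ fun c =>
    ∑ i : Fin (n + 2), (-1 : ℤ) ^ (i : ℕ) • Finsupp.single (X.face i c) 1

/-- The augmentation, the sum of the coefficients. -/
noncomputable def augmentation : X.Chain 0 →ₗ[ℤ] ℤ :=
  Finsupp.linearCombination ℤ fun _ => 1

/-- The chains supported on cells lying under `p`. -/
noncomputable def under (n : ℕ) (p : P) : Submodule ℤ (X.Chain n) :=
  Finsupp.supported ℤ ℤ {c | X.top c ≤ p}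

/-- The cycles of the augmented chain complex. -/
noncomputable def cycles : ∀ n, Submodule ℤ (X.Chain n)
  | 0 => LinearMap.ker X.augmentation
  | n + 1 => LinearMap.ker (X.boundary n)

variable {X}

lemma boundary_single {n : ℕ} (c : X.cell (n + 1)) :
    X.boundary n (Finsupp.single c 1) =
      ∑ i : Fin (n + 2), (-1 : ℤ) ^ (i : ℕ) • Finsupp.single (X.face i c) 1 := by
  simp [boundary]

lemma augmentation_single (c : X.cell 0) : X.augmentation (Finsupp.single c 1) = 1 := by
  simp [augmentation]

lemma single_mem_under {n : ℕ} {p : P} {c : X.cell n} (h : X.top c ≤ p) (a : ℤ) :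
    Finsupp.single c a ∈ X.under n p :=
  Finsupp.single_mem_supported ℤ a h

lemma under_mono {n : ℕ} {p q : P} (h : p ≤ q) : X.under n p ≤ X.under n q :=
  Finsupp.supported_mono fun _ hc => le_trans hc h

lemma under_induction {n : ℕ} {p : P} {motive : ∀ x : X.Chain n, x ∈ X.under n p → Prop}
    (zero : motive 0 (zero_mem _))
    (add : ∀ x y hx hy, motive x hx → motive y hy → motive (x + y) (add_mem hx hy))
    (smul : ∀ (a : ℤ) x hx, motive x hx → motive (a • x) (Submodule.smul_mem _ a hx))
    (single : ∀ (c : X.cell n) (hc : X.top c ≤ p),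
      motive (Finsupp.single c 1) (single_mem_under hc 1))
    {x : X.Chain n} (hx : x ∈ X.under n p) : motive x hx := by
  have hspan : X.under n p =
      Submodule.span ℤ ((fun c => Finsupp.single c (1 : ℤ)) '' {c | X.top c ≤ p}) :=
    Finsupp.supported_eq_span_single ℤ _
  suffices h : ∃ hx, motive x hx from h.2
  rw [hspan] at hx
  induction hx using Submodule.span_induction with
  | mem x hx => obtain ⟨c, hc, rfl⟩ := hx; exact ⟨_, single c hc⟩
  | zero => exact ⟨_, zero⟩
  | add x y _ _ hx hy => exact ⟨_, add x y _ _ hx.2 hy.2⟩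
  | smul a x _ hx => exact ⟨_, smul a x _ hx.2⟩

lemma chain_ext {n : ℕ} {N : Type*} [AddCommGroup N] {f g : X.Chain n →ₗ[ℤ] N}
    (h : ∀ c, f (Finsupp.single c 1) = g (Finsupp.single c 1)) : f = g :=
  Finsupp.lhom_ext' fun c => LinearMap.ext_ring (h c)

lemma mapDomain_boundary (n : ℕ) (x : X.Chain (n + 1)) :
    Finsupp.lmapDomain ℤ ℤ X.vert (X.boundary n x) =
      tupleBoundary T (n + 1) (Finsupp.lmapDomain ℤ ℤ X.vert x) := by
  refine LinearMap.congr_fun (f := Finsupp.lmapDomain ℤ ℤ X.vert ∘ₗ X.boundary n)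
    (g := tupleBoundary T (n + 1) ∘ₗ Finsupp.lmapDomain ℤ ℤ X.vert) (chain_ext fun c => ?_) x
  simp only [LinearMap.comp_apply, boundary_single, map_sum, map_smul, Finsupp.lmapDomain_apply,
    Finsupp.mapDomain_single, tupleBoundary_single, vert_face]

lemma boundary_boundary (n : ℕ) (x : X.Chain (n + 2)) :
    X.boundary n (X.boundary (n + 1) x) = 0 := by
  apply Finsupp.mapDomain_injective (X.vert_injective n)
  rw [← Finsupp.lmapDomain_apply ℤ ℤ, mapDomain_boundary, mapDomain_boundary,
    tupleBoundary_tupleBoundary, Finsupp.mapDomain_zero]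

lemma augmentation_boundary (x : X.Chain 1) : X.augmentation (X.boundary 0 x) = 0 := by
  refine LinearMap.congr_fun (f := X.augmentation ∘ₗ X.boundary 0) (g := 0)
    (chain_ext fun c => ?_) x
  simp [boundary_single, augmentation_single, Fin.sum_univ_succ]

lemma boundary_mem_cycles (n : ℕ) (x : X.Chain (n + 1)) : X.boundary n x ∈ X.cycles n := by
  cases n with
  | zero => exact augmentation_boundary x
  | succ n => exact boundary_boundary n x

open Classical in
/-- The cone with vertex `X.apex p`. -/
noncomputable def cone (X : CellFamily P T) (p : P) (n : ℕ) : X.Chain n →ₗ[ℤ] X.Chain (n + 1) :=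
  Finsupp.linearCombination ℤ fun c =>
    if h : ∃ c' : X.cell (n + 1), X.vert c' = Fin.cons (X.apex p) (X.vert c) ∧ X.top c' ≤ p then
      Finsupp.single h.choose 1 else 0

lemma cone_single_eq {p : P} {n : ℕ} {c : X.cell n} {c' : X.cell (n + 1)}
    (h : X.vert c' = Fin.cons (X.apex p) (X.vert c)) (h' : X.top c' ≤ p) :
    X.cone p n (Finsupp.single c 1) = Finsupp.single c' 1 := by
  have hex : ∃ c' : X.cell (n + 1), X.vert c' = Fin.cons (X.apex p) (X.vert c) ∧ X.top c' ≤ p :=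
    ⟨c', h, h'⟩
  have : hex.choose = c' := X.vert_injective _ (hex.choose_spec.1.trans h.symm)
  simp [cone, dif_pos hex, this]

lemma cone_single_eq_zero {p : P} {n : ℕ} {c : X.cell n} (h : X.vert c 0 = X.apex p) :
    X.cone p n (Finsupp.single c 1) = 0 := by
  have hex : ¬ ∃ c' : X.cell (n + 1),
      X.vert c' = Fin.cons (X.apex p) (X.vert c) ∧ X.top c' ≤ p := by
    rintro ⟨c', hc', -⟩
    apply X.vert_zero_ne_one c'
    rw [hc', Fin.cons_zero, ← Fin.succ_zero_eq_one, Fin.cons_succ, h]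
  simp [cone, dif_neg hex]

lemma cone_mem_under {p : P} {n : ℕ} {x : X.Chain n} (hx : x ∈ X.under n p) :
    X.cone p n x ∈ X.under (n + 1) p := by
  induction hx using under_induction with
  | zero => simp
  | add x y _ _ hx hy => rw [map_add]; exact add_mem hx hy
  | smul a x _ hx => rw [map_smul]; exact Submodule.smul_mem _ a hx
  | single c hc =>
    by_cases h : X.vert c 0 = X.apex p
    · rw [cone_single_eq_zero h]; exact zero_mem _
    · obtain ⟨c', h₁, h₂⟩ := X.exists_cone p c hc h
      rw [cone_single_eq h₁ h₂]; exact single_mem_under h₂ 1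

lemma boundary_cone_zero {p : P} {c₀ : X.cell 0} (h₀ : X.vert c₀ 0 = X.apex p)
    {x : X.Chain 0} (hx : x ∈ X.under 0 p) :
    X.boundary 0 (X.cone p 0 x) = x - X.augmentation x • Finsupp.single c₀ 1 := by
  induction hx using under_induction with
  | zero => simp
  | add x y _ _ hx hy => simp only [map_add, hx, hy, add_smul]; abel
  | smul a x _ hx => simp only [map_smul, hx, smul_sub, smul_assoc]
  | single c hc =>
    rw [augmentation_single, one_smul]
    by_cases h : X.vert c 0 = X.apex p
    · have : c = c₀ := X.vert_injective 0 (funext fun j => by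
        obtain rfl : j = 0 := Fin.fin_one_eq_zero j
        rw [h, h₀])
      rw [cone_single_eq_zero h, this, map_zero, sub_self]
    · obtain ⟨c', h₁, h₂⟩ := X.exists_cone p c hc h
      have hf0 : X.face 0 c' = c := X.vert_injective 0 (by rw [X.vert_face, h₁]; simp)
      have hf1 : X.face 1 c' = c₀ := X.vert_injective 0 (by
        rw [X.vert_face, h₁]
        funext j
        obtain rfl : j = 0 := Fin.fin_one_eq_zero j
        rw [h₀]
        simp)
      rw [cone_single_eq h₁ h₂, boundary_single, Fin.sum_univ_two, hf0, hf1]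
      simp [sub_eq_add_neg]

lemma boundary_cone_succ {p : P} {n : ℕ} {x : X.Chain (n + 1)} (hx : x ∈ X.under (n + 1) p) :
    X.boundary (n + 1) (X.cone p (n + 1) x) = x - X.cone p n (X.boundary n x) := by
  induction hx using under_induction with
  | zero => simp
  | add x y _ _ hx hy => simp only [map_add, hx, hy]; abel
  | smul a x _ hx => simp only [map_smul, hx, smul_sub]
  | single c hc =>
    by_cases h : X.vert c 0 = X.apex p
    · have hz : X.cone p n (Finsupp.single (X.face 0 c) 1) = Finsupp.single c 1 := by
        refine cone_single_eq ?_ hc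
        rw [X.vert_face, ← h]
        exact (Fin.cons_self_tail _).symm
      have hs (i : Fin (n + 1)) :
          X.cone p n (Finsupp.single (X.face i.succ c) 1) = 0 := by
        refine cone_single_eq_zero ?_
        rw [X.vert_face, ← h]
        simp
      rw [cone_single_eq_zero h, boundary_single, Fin.sum_univ_succ]
      simp [-Finsupp.smul_single, hz, hs]
    · obtain ⟨c', h₁, h₂⟩ := X.exists_cone p c hc h
      have hz : X.face 0 c' = c := X.vert_injective _ (by rw [X.vert_face, h₁]; simp)
      have hs (i : Fin (n + 2)) : X.cone p n (Finsupp.single (X.face i c) 1) =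
          Finsupp.single (X.face i.succ c') 1 := by
        refine cone_single_eq ?_ ((X.top_face _ _).trans h₂)
        rw [X.vert_face, h₁, Fin.cons_succ_succAbove, X.vert_face]
      rw [cone_single_eq h₁ h₂, boundary_single, boundary_single, Fin.sum_univ_succ, hz]
      simp [-Finsupp.smul_single, hs, pow_succ, sub_eq_add_neg]

lemma exists_boundary_eq {n : ℕ} {p : P} {x : X.Chain n} (hx : x ∈ X.under n p)
    (hz : x ∈ X.cycles n) : ∃ y ∈ X.under (n + 1) p, X.boundary n y = x := by
  refine ⟨X.cone p n x, cone_mem_under hx, ?_⟩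
  cases n with
  | zero =>
    obtain ⟨c₀, h₀, -⟩ := X.exists_apex p
    have hz : X.augmentation x = 0 := hz
    rw [boundary_cone_zero h₀ hx, hz, zero_smul, sub_zero]
  | succ n =>
    have hz : X.boundary n x = 0 := hz
    rw [boundary_cone_succ hx, hz, map_zero, sub_zero]

end Chains

section LocalMaps

variable {T' T'' : Type*} {X : CellFamily P T} {Y : CellFamily P T'} {Z : CellFamily P T''}

/-- A map of chains is local if it sends each cell to a chain supported under the top of the
cell. -/
def IsLocal {n m : ℕ} (Φ : X.Chain n →ₗ[ℤ] Y.Chain m) : Prop :=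
  ∀ c, Φ (Finsupp.single c 1) ∈ Y.under m (X.top c)

lemma IsLocal.mem_under {n m : ℕ} {Φ : X.Chain n →ₗ[ℤ] Y.Chain m} (hΦ : IsLocal Φ) {p : P}
    {x : X.Chain n} (hx : x ∈ X.under n p) : Φ x ∈ Y.under m p := by
  induction hx using under_induction with
  | zero => simp
  | add x y _ _ hx hy => rw [map_add]; exact add_mem hx hy
  | smul a x _ hx => rw [map_smul]; exact Submodule.smul_mem _ a hx
  | single c hc => exact under_mono hc (hΦ c)

lemma IsLocal.comp {n m l : ℕ} {Ψ : Y.Chain m →ₗ[ℤ] Z.Chain l} {Φ : X.Chain n →ₗ[ℤ] Y.Chain m}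
    (hΨ : IsLocal Ψ) (hΦ : IsLocal Φ) : IsLocal (Ψ ∘ₗ Φ) :=
  fun c => hΨ.mem_under (hΦ c)

lemma IsLocal.sub {n m : ℕ} {Φ Ψ : X.Chain n →ₗ[ℤ] Y.Chain m}
    (hΦ : IsLocal Φ) (hΨ : IsLocal Ψ) : IsLocal (Φ - Ψ) :=
  fun c => sub_mem (hΦ c) (hΨ c)

lemma isLocal_id {n : ℕ} : IsLocal (LinearMap.id : X.Chain n →ₗ[ℤ] X.Chain n) :=
  fun _ => single_mem_under le_rfl 1

lemma isLocal_boundary (n : ℕ) : IsLocal (X.boundary n) := fun c => by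
  rw [boundary_single]
  exact Submodule.sum_mem _ fun i _ =>
    Submodule.smul_mem _ _ (single_mem_under (X.top_face i c) 1)

lemma exists_isLocal {n m : ℕ} (q : X.cell n → Y.Chain m → Prop)
    (h : ∀ c, ∃ y ∈ Y.under m (X.top c), q c y) :
    ∃ Φ : X.Chain n →ₗ[ℤ] Y.Chain m, IsLocal Φ ∧ ∀ c, q c (Φ (Finsupp.single c 1)) := by
  choose y hy hq using h
  exact ⟨Finsupp.linearCombination ℤ y, fun c => by simpa using hy c, fun c => by simpa using hq c⟩

/-- A local map with values in cycles lifts through the boundary map. -/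
lemma IsLocal.exists_lift {n m : ℕ} {Φ : X.Chain n →ₗ[ℤ] Y.Chain m} (hΦ : IsLocal Φ)
    (hz : ∀ x, Φ x ∈ Y.cycles m) :
    ∃ Ψ : X.Chain n →ₗ[ℤ] Y.Chain (m + 1), IsLocal Ψ ∧ Y.boundary m ∘ₗ Ψ = Φ := by
  obtain ⟨Ψ, hΨ, h⟩ := exists_isLocal (fun c y => Y.boundary m y = Φ (Finsupp.single c 1))
    fun c => exists_boundary_eq (hΦ c) (hz _)
  exact ⟨Ψ, hΨ, chain_ext h⟩

end LocalMaps

lemma _root_.exists_dependent_seq {α : ℕ → Type*} (p : ∀ n, α n → Prop)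
    (q : ∀ n, α n → α (n + 1) → Prop) (a : α 0) (ha : p 0 a)
    (hs : ∀ n a, p n a → ∃ b, p (n + 1) b ∧ q n a b) :
    ∃ f : ∀ n, α n, (∀ n, p n (f n)) ∧ f 0 = a ∧ ∀ n, q n (f n) (f (n + 1)) := by
  choose g hg hq using hs
  let F : ∀ n, {a : α n // p n a} := fun n =>
    Nat.rec ⟨a, ha⟩ (fun n b => ⟨g n b.1 b.2, hg n b.1 b.2⟩) n
  exact ⟨fun n => (F n).1, fun n => (F n).2, rfl, fun n => hq n (F n).1 (F n).2⟩

section ChainMaps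

variable {T' T'' : Type*} {X : CellFamily P T} {Y : CellFamily P T'} {Z : CellFamily P T''}

/-- Local chain maps compatible with the augmentations. -/
structure IsChainMap (φ : ∀ n, X.Chain n →ₗ[ℤ] Y.Chain n) : Prop where
  isLocal : ∀ n, IsLocal (φ n)
  comm : ∀ n x, Y.boundary n (φ (n + 1) x) = φ n (X.boundary n x)
  aug : ∀ x, Y.augmentation (φ 0 x) = X.augmentation x

lemma IsChainMap.comp {ψ : ∀ n, Y.Chain n →ₗ[ℤ] Z.Chain n} {φ : ∀ n, X.Chain n →ₗ[ℤ] Y.Chain n}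
    (hψ : IsChainMap ψ) (hφ : IsChainMap φ) : IsChainMap fun n => ψ n ∘ₗ φ n where
  isLocal n := (hψ.isLocal n).comp (hφ.isLocal n)
  comm n x := by simp [hψ.comm, hφ.comm]
  aug x := by simp [hψ.aug, hφ.aug]

lemma isChainMap_id : IsChainMap fun n => (LinearMap.id : X.Chain n →ₗ[ℤ] X.Chain n) where
  isLocal _ := isLocal_id
  comm _ _ := rfl
  aug _ := rfl

variable (X Y) in
/-- Existence part of the comparison theorem for acyclic families of cells. -/
theorem exists_isChainMap : ∃ φ : ∀ n, X.Chain n →ₗ[ℤ] Y.Chain n, IsChainMap φ := by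
  obtain ⟨φ₀, hφ₀, haug⟩ := exists_isLocal (X := X) (Y := Y) (n := 0) (m := 0)
    (fun _ y => Y.augmentation y = 1) fun c => by
      obtain ⟨c', -, hc'⟩ := Y.exists_apex (X.top c)
      exact ⟨_, single_mem_under hc' 1, augmentation_single c'⟩
  have haug : Y.augmentation ∘ₗ φ₀ = X.augmentation :=
    chain_ext fun c => (haug c).trans (augmentation_single c).symm
  obtain ⟨φ, hφ, rfl, hcomm⟩ := exists_dependent_seq
    (α := fun n => X.Chain n →ₗ[ℤ] Y.Chain n)
    (fun n φ => IsLocal φ ∧ ∀ x ∈ X.cycles n, φ x ∈ Y.cycles n)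
    (fun n φ φ' => Y.boundary n ∘ₗ φ' = φ ∘ₗ X.boundary n)
    φ₀ ⟨hφ₀, fun x hx => (LinearMap.congr_fun haug x).trans hx⟩
    (fun n φ ⟨hφ, hz⟩ => by
      obtain ⟨φ', hφ', h⟩ := (hφ.comp (isLocal_boundary n)).exists_lift
        fun x => hz _ (boundary_mem_cycles n x)
      refine ⟨φ', ⟨hφ', fun x hx => ?_⟩, h⟩
      have hx : X.boundary n x = 0 := hx
      exact (LinearMap.congr_fun h x).trans (by simp [hx]))
  exact ⟨φ, fun n => (hφ n).1, fun n => LinearMap.congr_fun (hcomm n), LinearMap.congr_fun haug⟩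

/-- Uniqueness part of the comparison theorem for acyclic families of cells. -/
theorem IsChainMap.exists_homotopy {φ ψ : ∀ n, X.Chain n →ₗ[ℤ] Y.Chain n}
    (hφ : IsChainMap φ) (hψ : IsChainMap ψ) :
    ∃ D : ∀ n, X.Chain n →ₗ[ℤ] Y.Chain (n + 1), (∀ n, IsLocal (D n)) ∧
      φ 0 - ψ 0 = Y.boundary 0 ∘ₗ D 0 ∧
      ∀ n, φ (n + 1) - ψ (n + 1) = Y.boundary (n + 1) ∘ₗ D (n + 1) + D n ∘ₗ X.boundary n := by
  obtain ⟨D₀, hD₀, h₀⟩ := ((hφ.isLocal 0).sub (hψ.isLocal 0)).exists_lift fun x =>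
    show Y.augmentation _ = 0 by simp [hφ.aug, hψ.aug]
  obtain ⟨D, hD, rfl, hcomm⟩ := exists_dependent_seq
    (α := fun n => X.Chain n →ₗ[ℤ] Y.Chain (n + 1))
    (fun n D => IsLocal D ∧ (∀ x, Y.boundary n (D (X.boundary n x)) =
      φ n (X.boundary n x) - ψ n (X.boundary n x)))
    (fun n D D' => φ (n + 1) - ψ (n + 1) = Y.boundary (n + 1) ∘ₗ D' + D ∘ₗ X.boundary n)
    D₀ ⟨hD₀, fun x => LinearMap.congr_fun h₀ _⟩
    (fun n D ⟨hD, hz⟩ => by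
      obtain ⟨D', hD', h⟩ := (((hφ.isLocal (n + 1)).sub (hψ.isLocal (n + 1))).sub
        (hD.comp (isLocal_boundary n))).exists_lift fun x =>
          show Y.boundary n _ = 0 by simp [hφ.comm, hψ.comm, hz]
      refine ⟨D', ⟨hD', fun x => ?_⟩, by rw [h, sub_add_cancel]⟩
      exact (LinearMap.congr_fun h _).trans (by simp [boundary_boundary]))
  exact ⟨D, fun n => (hD n).1, h₀.symm, hcomm⟩

end ChainMaps

section Cochains

variable {T' T'' : Type*} {X : CellFamily P T} {Y : CellFamily P T'} {Z : CellFamily P T''}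
variable {R : Type*} [CommRing R] {F : P → Type*} [∀ p, AddCommGroup (F p)] [∀ p, Module R (F p)]

/-- Cochains with coefficients in a family of modules indexed by `P`. -/
abbrev Cochain (X : CellFamily P T) (F : P → Type*) (n : ℕ) : Type _ :=
  ∀ c : X.cell n, F (X.top c)

/-- A functor from the preorder `P` to `R`-modules, with values `F`. -/
structure Restriction (R : Type*) [CommRing R] (F : P → Type*) [∀ p, AddCommGroup (F p)]
    [∀ p, Module R (F p)] where
  map : ∀ {p q : P}, p ≤ q → F p →ₗ[R] F q
  map_refl : ∀ (p : P) (x : F p), map le_rfl x = x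
  map_map : ∀ {p q r : P} (h : p ≤ q) (h' : q ≤ r) (x : F p),
    map h' (map h x) = map (h.trans h') x

variable (ρ : Restriction R F)

open Classical in
/-- The pairing of a cochain with the chains supported under `p`. -/
noncomputable def pairing {n : ℕ} (p : P) (f : Y.Cochain F n) : Y.Chain n →ₗ[ℤ] F p :=
  Finsupp.linearCombination ℤ fun c => if h : Y.top c ≤ p then ρ.map h (f c) else 0

variable {ρ}

lemma pairing_single {n : ℕ} {p : P} (f : Y.Cochain F n) {c : Y.cell n} (h : Y.top c ≤ p) :
    pairing ρ p f (Finsupp.single c 1) = ρ.map h (f c) := by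
  simp [pairing, dif_pos h]

lemma map_pairing {n : ℕ} {p q : P} (h : p ≤ q) (f : Y.Cochain F n) {x : Y.Chain n}
    (hx : x ∈ Y.under n p) : ρ.map h (pairing ρ p f x) = pairing ρ q f x := by
  induction hx using under_induction with
  | zero => simp
  | add x y _ _ hx hy => simp only [map_add, hx, hy]
  | smul a x _ hx => simp only [map_zsmul, hx]
  | single c hc => rw [pairing_single f hc, pairing_single f (hc.trans h), ρ.map_map]

variable (ρ)

lemma pairing_add {n : ℕ} (p : P) (f g : Y.Cochain F n) :
    pairing ρ p (f + g) = pairing ρ p f + pairing ρ p g := by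
  refine chain_ext fun c => ?_
  by_cases h : Y.top c ≤ p <;> simp [pairing, h]

lemma pairing_smul {n : ℕ} (p : P) (r : R) (f : Y.Cochain F n) (x : Y.Chain n) :
    pairing ρ p (r • f) x = r • pairing ρ p f x := by
  induction x using Finsupp.induction_linear with
  | zero => simp
  | add x y hx hy => simp only [map_add, hx, hy, smul_add]
  | single c a =>
    by_cases h : Y.top c ≤ p <;> simp [pairing, h, smul_comm r a]

/-- The map on cochains induced by a map of chains. -/
noncomputable def pullback {n m : ℕ} (Φ : X.Chain n →ₗ[ℤ] Y.Chain m) :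
    Y.Cochain F m →ₗ[R] X.Cochain F n where
  toFun f c := pairing ρ (X.top c) f (Φ (Finsupp.single c 1))
  map_add' f g := by ext c; simp [pairing_add]
  map_smul' r f := by ext c; simp [pairing_smul]

lemma pullback_apply {n m : ℕ} (Φ : X.Chain n →ₗ[ℤ] Y.Chain m) (f : Y.Cochain F m)
    (c : X.cell n) :
    pullback ρ Φ f c = pairing ρ (X.top c) f (Φ (Finsupp.single c 1)) := rfl

lemma pullback_id {n : ℕ} (f : X.Cochain F n) :
    pullback ρ (LinearMap.id : X.Chain n →ₗ[ℤ] X.Chain n) f = f := by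
  ext c
  rw [pullback_apply, LinearMap.id_apply, pairing_single f le_rfl, ρ.map_refl]

lemma pullback_add {n m : ℕ} (Φ Ψ : X.Chain n →ₗ[ℤ] Y.Chain m) (f : Y.Cochain F m) :
    pullback ρ (Φ + Ψ) f = pullback ρ Φ f + pullback ρ Ψ f := by
  ext c; simp [pullback_apply]

lemma pullback_sub {n m : ℕ} (Φ Ψ : X.Chain n →ₗ[ℤ] Y.Chain m) (f : Y.Cochain F m) :
    pullback ρ (Φ - Ψ) f = pullback ρ Φ f - pullback ρ Ψ f := by
  ext c; simp [pullback_apply]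

lemma pairing_pullback {n m : ℕ} {Φ : X.Chain n →ₗ[ℤ] Y.Chain m} (hΦ : IsLocal Φ)
    (f : Y.Cochain F m) {p : P} {x : X.Chain n} (hx : x ∈ X.under n p) :
    pairing ρ p (pullback ρ Φ f) x = pairing ρ p f (Φ x) := by
  induction hx using under_induction with
  | zero => simp
  | add x y _ _ hx hy => simp only [map_add, hx, hy]
  | smul a x _ hx => simp only [map_smul, hx]
  | single c hc => rw [pairing_single _ hc, pullback_apply, map_pairing hc f (hΦ c)]

lemma pullback_comp {n m l : ℕ} {Ψ : Y.Chain m →ₗ[ℤ] Z.Chain l} {Φ : X.Chain n →ₗ[ℤ] Y.Chain m}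
    (hΨ : IsLocal Ψ) (hΦ : IsLocal Φ) (f : Z.Cochain F l) :
    pullback ρ (Ψ ∘ₗ Φ) f = pullback ρ Φ (pullback ρ Ψ f) := by
  ext c
  rw [pullback_apply, pullback_apply, pairing_pullback ρ hΨ f (hΦ c), LinearMap.comp_apply]

/-- The coboundary map with coefficients in `F`. -/
noncomputable def coboundary (X : CellFamily P T) (n : ℕ) :
    X.Cochain F n →ₗ[R] X.Cochain F (n + 1) :=
  pullback ρ (X.boundary n)

lemma coboundary_apply {n : ℕ} (f : X.Cochain F n) (c : X.cell (n + 1)) :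
    coboundary ρ X n f c =
      ∑ i : Fin (n + 2), (-1 : ℤ) ^ (i : ℕ) • ρ.map (X.top_face i c) (f (X.face i c)) := by
  rw [coboundary, pullback_apply, boundary_single, map_sum]
  exact Finset.sum_congr rfl fun i _ => by rw [map_smul, pairing_single f (X.top_face i c)]

lemma IsChainMap.coboundary_pullback {φ : ∀ n, X.Chain n →ₗ[ℤ] Y.Chain n} (hφ : IsChainMap φ)
    (n : ℕ) (f : Y.Cochain F n) :
    coboundary ρ X n (pullback ρ (φ n) f) = pullback ρ (φ (n + 1)) (coboundary ρ Y n f) := by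
  rw [coboundary, coboundary, ← pullback_comp ρ (hφ.isLocal n) (isLocal_boundary n),
    ← pullback_comp ρ (isLocal_boundary n) (hφ.isLocal (n + 1))]
  congr 2
  exact LinearMap.ext fun x => (hφ.comm n x).symm

lemma IsChainMap.pullback_zero_eq {φ : ∀ n, X.Chain n →ₗ[ℤ] X.Chain n} (hφ : IsChainMap φ)
    {f : X.Cochain F 0} (hf : coboundary ρ X 0 f = 0) : pullback ρ (φ 0) f = f := by
  obtain ⟨D, hD, h₀, -⟩ := hφ.exists_homotopy isChainMap_id
  have h := pullback_sub ρ (φ 0) LinearMap.id f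
  rw [h₀, pullback_comp ρ (isLocal_boundary 0) (hD 0)] at h
  change pullback ρ (D 0) (coboundary ρ X 0 f) = _ at h
  rw [hf, map_zero, pullback_id] at h
  exact (sub_eq_zero.mp h.symm)

lemma IsChainMap.pullback_succ_sub_mem {φ : ∀ n, X.Chain n →ₗ[ℤ] X.Chain n} (hφ : IsChainMap φ)
    {n : ℕ} {f : X.Cochain F (n + 1)} (hf : coboundary ρ X (n + 1) f = 0) :
    pullback ρ (φ (n + 1)) f - f ∈ LinearMap.range (coboundary ρ X n) := by
  obtain ⟨D, hD, -, h⟩ := hφ.exists_homotopy isChainMap_id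
  refine ⟨pullback ρ (D n) f, ?_⟩
  have hsub := pullback_sub ρ (φ (n + 1)) LinearMap.id f
  rw [h n, pullback_add, pullback_comp ρ (isLocal_boundary _) (hD _),
    pullback_comp ρ (hD n) (isLocal_boundary n), pullback_id] at hsub
  change pullback ρ (D (n + 1)) (coboundary ρ X (n + 1) f) + _ = _ at hsub
  rw [hf, map_zero, zero_add] at hsub
  exact hsub

end Cochains

section Comparison

variable {R : Type*} [CommRing R]

lemma _root_.Submodule.nonempty_subquotient_equiv {A B : Type*} [AddCommGroup A] [AddCommGroup B]
    [Module R A] [Module R B] {ZA BA : Submodule R A} {ZB BB : Submodule R B}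
    (f : A →ₗ[R] B) (g : B →ₗ[R] A) (hfZ : ∀ x ∈ ZA, f x ∈ ZB) (hgZ : ∀ x ∈ ZB, g x ∈ ZA)
    (hfB : ∀ x ∈ BA, f x ∈ BB) (hgB : ∀ x ∈ BB, g x ∈ BA)
    (hgf : ∀ x ∈ ZA, g (f x) - x ∈ BA) (hfg : ∀ x ∈ ZB, f (g x) - x ∈ BB) :
    Nonempty ((ZA ⧸ BA.comap ZA.subtype) ≃ₗ[R] (ZB ⧸ BB.comap ZB.subtype)) := by
  refine ⟨LinearEquiv.ofLinearMap
    (Submodule.mapQ _ _ (f.restrict hfZ) fun x hx => hfB _ hx)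
    (Submodule.mapQ _ _ (g.restrict hgZ) fun x hx => hgB _ hx) ?_ ?_⟩
  · refine Submodule.linearMap_qext _ (LinearMap.ext fun x => ?_)
    exact (Submodule.Quotient.eq _).mpr (hfg x x.2)
  · refine Submodule.linearMap_qext _ (LinearMap.ext fun x => ?_)
    exact (Submodule.Quotient.eq _).mpr (hgf x x.2)

variable {T' : Type*} (X : CellFamily P T) (Y : CellFamily P T')
variable {F : P → Type*} [∀ p, AddCommGroup (F p)] [∀ p, Module R (F p)] (ρ : Restriction R F)

/-- The cohomology in degree zero does not depend on the family of cells. -/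
theorem nonempty_ker_coboundary_zero_equiv :
    Nonempty (LinearMap.ker (coboundary ρ X 0) ≃ₗ[R] LinearMap.ker (coboundary ρ Y 0)) := by
  obtain ⟨φ, hφ⟩ := exists_isChainMap X Y
  obtain ⟨ψ, hψ⟩ := exists_isChainMap Y X
  have hφZ : ∀ f ∈ LinearMap.ker (coboundary ρ Y 0),
      pullback ρ (φ 0) f ∈ LinearMap.ker (coboundary ρ X 0) := fun f hf => by
    rw [LinearMap.mem_ker] at hf ⊢
    rw [hφ.coboundary_pullback, hf, map_zero]
  have hψZ : ∀ f ∈ LinearMap.ker (coboundary ρ X 0),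
      pullback ρ (ψ 0) f ∈ LinearMap.ker (coboundary ρ Y 0) := fun f hf => by
    rw [LinearMap.mem_ker] at hf ⊢
    rw [hψ.coboundary_pullback, hf, map_zero]
  refine ⟨LinearEquiv.ofLinearMap ((pullback ρ (ψ 0)).restrict hψZ)
    ((pullback ρ (φ 0)).restrict hφZ) ?_ ?_⟩
  · refine LinearMap.ext fun f => Subtype.ext ?_
    exact (pullback_comp ρ (hφ.isLocal 0) (hψ.isLocal 0) f.1).symm.trans
      ((hφ.comp hψ).pullback_zero_eq ρ f.2)
  · refine LinearMap.ext fun f => Subtype.ext ?_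
    exact (pullback_comp ρ (hψ.isLocal 0) (hφ.isLocal 0) f.1).symm.trans
      ((hψ.comp hφ).pullback_zero_eq ρ f.2)

/-- The cohomology in positive degrees does not depend on the family of cells. -/
theorem nonempty_cohomology_succ_equiv (n : ℕ) :
    Nonempty
      ((LinearMap.ker (coboundary ρ X (n + 1)) ⧸
          Submodule.comap (LinearMap.ker (coboundary ρ X (n + 1))).subtype
            (LinearMap.range (coboundary ρ X n))) ≃ₗ[R]
        (LinearMap.ker (coboundary ρ Y (n + 1)) ⧸
          Submodule.comap (LinearMap.ker (coboundary ρ Y (n + 1))).subtype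
            (LinearMap.range (coboundary ρ Y n)))) := by
  obtain ⟨φ, hφ⟩ := exists_isChainMap X Y
  obtain ⟨ψ, hψ⟩ := exists_isChainMap Y X
  refine Submodule.nonempty_subquotient_equiv (pullback ρ (ψ (n + 1))) (pullback ρ (φ (n + 1)))
    (fun f hf => ?_) (fun f hf => ?_) ?_ ?_ (fun f hf => ?_) (fun f hf => ?_)
  · rw [LinearMap.mem_ker] at hf ⊢
    rw [hψ.coboundary_pullback, hf, map_zero]
  · rw [LinearMap.mem_ker] at hf ⊢
    rw [hφ.coboundary_pullback, hf, map_zero]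
  · rintro _ ⟨f, rfl⟩
    exact ⟨_, hψ.coboundary_pullback ρ n f⟩
  · rintro _ ⟨f, rfl⟩
    exact ⟨_, hφ.coboundary_pullback ρ n f⟩
  · rw [← pullback_comp ρ (hψ.isLocal _) (hφ.isLocal _)]
    exact (hψ.comp hφ).pullback_succ_sub_mem ρ hf
  · rw [← pullback_comp ρ (hφ.isLocal _) (hψ.isLocal _)]
    exact (hφ.comp hψ).pullback_succ_sub_mem ρ hf

/-- Two coboundary maps given by families of cells over `P` have isomorphic cohomology. -/
theorem nonempty_cohomology_equiv
    {dX : ∀ n, X.Cochain F n →ₗ[R] X.Cochain F (n + 1)}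
    {dY : ∀ n, Y.Cochain F n →ₗ[R] Y.Cochain F (n + 1)}
    (hX : ∀ n, dX n = coboundary ρ X n) (hY : ∀ n, dY n = coboundary ρ Y n) :
    Nonempty (LinearMap.ker (dX 0) ≃ₗ[R] LinearMap.ker (dY 0)) ∧
    ∀ n : ℕ,
      Nonempty
        ((LinearMap.ker (dX (n + 1)) ⧸
            Submodule.comap (LinearMap.ker (dX (n + 1))).subtype (LinearMap.range (dX n))) ≃ₗ[R]
          (LinearMap.ker (dY (n + 1)) ⧸
            Submodule.comap (LinearMap.ker (dY (n + 1))).subtype (LinearMap.range (dY n)))) := by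
  obtain rfl : dX = coboundary ρ X := funext hX
  obtain rfl : dY = coboundary ρ Y := funext hY
  exact ⟨nonempty_ker_coboundary_zero_equiv X Y ρ, nonempty_cohomology_succ_equiv X Y ρ⟩

end Comparison

end CellFamily

section Faces

variable {V : Type} [LinearOrder V] (K : Set (Finset V))

instance Face.instPreorder : Preorder (Face K) := Preorder.lift Subtype.val

/-- The simplices of `K`, with vertices in increasing order. -/
noncomputable def simplexFamily (hne : ∀ σ ∈ K, σ.Nonempty)
    (hdown : ∀ σ ∈ K, ∀ τ, τ ⊆ σ → τ.Nonempty → τ ∈ K) : CellFamily (Face K) V where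
  cell n := {σ : Face K // σ.1.card = n + 1}
  vert σ := σ.1.1.orderEmbOfFin σ.2
  vert_injective n σ τ h := by
    refine Subtype.ext (Subtype.ext (Finset.coe_injective ?_))
    rw [← Finset.range_orderEmbOfFin σ.1.1 σ.2, ← Finset.range_orderEmbOfFin τ.1.1 τ.2]
    exact congrArg Set.range h
  face {n} i σ :=
    ⟨⟨σ.1.1.erase (σ.1.1.orderIsoOfFin σ.2 i).1,
      hdown σ.1.1 σ.1.2 _ (Finset.erase_subset _ _)
        (Finset.card_pos.mp (by
          rw [Finset.card_erase_of_mem (σ.1.1.orderIsoOfFin σ.2 i).2, σ.2]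
          omega))⟩,
      by
        rw [Finset.card_erase_of_mem (σ.1.1.orderIsoOfFin σ.2 i).2, σ.2]
        omega⟩
  vert_face i σ := by
    refine (Finset.orderEmbOfFin_unique _ (fun j => ?_) ?_).symm
    · refine Finset.mem_erase.mpr ⟨fun h => ?_, Finset.orderEmbOfFin_mem _ _ _⟩
      exact Fin.succAbove_ne i j ((σ.1.1.orderEmbOfFin σ.2).injective h)
    · exact (σ.1.1.orderEmbOfFin σ.2).strictMono.comp (Fin.strictMono_succAbove i)
  top σ := σ.1
  top_face i σ := Finset.erase_subset _ σ.1.1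
  vert_zero_ne_one σ h := by
    simpa using (σ.1.1.orderEmbOfFin σ.2).injective h
  apex p := p.1.min' (hne p.1 p.2)
  exists_apex p := by
    have hsub : {p.1.min' (hne p.1 p.2)} ⊆ p.1 := by simp [Finset.min'_mem]
    refine ⟨⟨⟨_, hdown p.1 p.2 _ hsub (Finset.singleton_nonempty _)⟩,
      Finset.card_singleton _⟩, ?_, hsub⟩
    exact Finset.mem_singleton.mp (Finset.orderEmbOfFin_mem _ _ _)
  exists_cone p n σ hσ h := by
    have hσ : σ.1.1 ⊆ p.1 := hσ
    have hmem : p.1.min' (hne p.1 p.2) ∉ σ.1.1 := fun hm => by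
      refine h (le_antisymm ?_ (Finset.min'_le _ _ (hσ (Finset.orderEmbOfFin_mem _ _ _))))
      obtain ⟨j, hj⟩ : p.1.min' (hne p.1 p.2) ∈ Set.range (σ.1.1.orderEmbOfFin σ.2) := by
        rwa [Finset.range_orderEmbOfFin]
      rw [← hj]
      exact (σ.1.1.orderEmbOfFin σ.2).monotone (Fin.zero_le j)
    have hsub : insert (p.1.min' (hne p.1 p.2)) σ.1.1 ⊆ p.1 :=
      Finset.insert_subset (Finset.min'_mem _ _) hσ
    refine ⟨⟨⟨_, hdown p.1 p.2 _ hsub (Finset.insert_nonempty _ _)⟩, by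
      rw [Finset.card_insert_of_notMem hmem, σ.2]⟩, ?_, hsub⟩
    refine (Finset.orderEmbOfFin_unique _ (fun j => ?_) ?_).symm
    · refine Fin.cases ?_ (fun k => ?_) j
      · exact Finset.mem_insert_self _ _
      · exact Finset.mem_insert_of_mem (Finset.orderEmbOfFin_mem _ _ _)
    · refine StrictMono.vecCons (σ.1.1.orderEmbOfFin σ.2).strictMono ?_
      exact lt_of_le_of_ne (Finset.min'_le _ _ (hσ (Finset.orderEmbOfFin_mem _ _ _))) (Ne.symm h)

/-- The flags of faces of `K`. -/
def flagFamily : CellFamily (Face K) (Face K) where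
  cell := FlagSimplex K
  vert c := c.1
  vert_injective _ := Subtype.val_injective
  face i c := ⟨fun j => c.1 (i.succAbove j), c.2.comp_strictMono (Fin.strictMono_succAbove i)⟩
  vert_face _ _ := rfl
  top c := c.1 0
  top_face i c := c.2.antitone (Fin.zero_le _)
  vert_zero_ne_one c h := by
    simpa using c.2.injective (congrArg Subtype.val h)
  apex p := p
  exists_apex p := ⟨⟨fun _ => p, fun i j h => absurd h (by omega)⟩, rfl, le_rfl⟩
  exists_cone p n c hc h := by
    refine ⟨⟨Fin.cons p c.1, Fin.strictAnti_iff_succ_lt.mpr fun i => ?_⟩, rfl, le_rfl⟩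
    refine Fin.cases ?_ (fun k => ?_) i
    · exact lt_of_le_of_ne hc fun h' => h (Subtype.ext h')
    · exact c.2 (Fin.castSucc_lt_succ (i := k))

variable {R : Type} [CommRing R] (M : Type) [AddCommGroup M] [Module R M]

lemma locMapOfLE_mk {S T : Submonoid R} (h : S ≤ T) (m : M) (s : S) :
    locMapOfLE M h (LocalizedModule.mk m s) = LocalizedModule.mk m ⟨s.1, h s.2⟩ := by
  rw [IsLocalizedModule.mk_eq_mk', IsLocalizedModule.mk_eq_mk']
  exact IsLocalizedModule.liftOfLE_mk' S T h (LocalizedModule.mkLinearMap S M)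
    (LocalizedModule.mkLinearMap T M) m s

/-- The dual system `σ ↦ S_σ⁻¹M`. -/
noncomputable def localizationRestriction (S : Face K → Submonoid R)
    (hmono : ∀ {τ σ : Face K}, τ.1 ⊆ σ.1 → S τ ≤ S σ) :
    CellFamily.Restriction R fun σ : Face K => LocalizedModule (S σ) M where
  map h := locMapOfLE M (hmono h)
  map_refl p x := by
    induction x using LocalizedModule.induction_on with
    | h m s => exact locMapOfLE_mk M _ m s
  map_map h h' x := by
    induction x using LocalizedModule.induction_on with
    | h m s => simp only [locMapOfLE_mk]

variable (S : Face K → Submonoid R) (hmono : ∀ {τ σ : Face K}, τ.1 ⊆ σ.1 → S τ ≤ S σ)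

lemma simpCoboundary_eq (hne : ∀ σ ∈ K, σ.Nonempty)
    (hdown : ∀ σ ∈ K, ∀ τ, τ ⊆ σ → τ.Nonempty → τ ∈ K) (n : ℕ) :
    simpCoboundary M K S hdown @hmono n =
      CellFamily.coboundary (localizationRestriction K M S @hmono)
        (simplexFamily K hne hdown) n := by
  refine LinearMap.ext fun f => funext fun c => ?_
  refine Eq.trans ?_ (CellFamily.coboundary_apply (X := simplexFamily K hne hdown)
    (localizationRestriction K M S @hmono) f c).symm
  simp only [simpCoboundary, LinearMap.pi_apply, LinearMap.sum_apply]
  rfl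

lemma adelicCoboundary_eq (n : ℕ) :
    adelicCoboundary M K S @hmono n =
      CellFamily.coboundary (localizationRestriction K M S @hmono) (flagFamily K) n := by
  refine LinearMap.ext fun f => funext fun c => ?_
  refine Eq.trans ?_ (CellFamily.coboundary_apply (X := flagFamily K)
    (localizationRestriction K M S @hmono) f c).symm
  simp only [adelicCoboundary, LinearMap.pi_apply, LinearMap.sum_apply]
  rfl

end Faces

/-- for a finite simplicial complex `K` with a monotone family of
multiplicative sets `S_σ ⊆ R` indexed by the faces, the cohomology of the adelic
(flag) cochain complex with cochains `∏_{σ₀ ⊋ ⋯ ⊋ σₛ} S_{σ₀}⁻¹M` is isomorphic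
to the simplicial cohomology of `K` with coefficients in `σ ↦ S_σ⁻¹M`. -/
theorem adelic_eq_simplicial_cohomology
    {R : Type} [CommRing R] (M : Type) [AddCommGroup M] [Module R M]
    {V : Type} [LinearOrder V] (K : Set (Finset V))
    (hfin : K.Finite)
    (hne : ∀ σ ∈ K, σ.Nonempty)
    (hdown : ∀ σ ∈ K, ∀ τ, τ ⊆ σ → τ.Nonempty → τ ∈ K)
    (S : Face K → Submonoid R)
    (hmono : ∀ {τ σ : Face K}, τ.1 ⊆ σ.1 → S τ ≤ S σ) :
    Nonempty
      (LinearMap.ker (adelicCoboundary M K S @hmono 0) ≃ₗ[R]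
        LinearMap.ker (simpCoboundary M K S hdown @hmono 0)) ∧
    ∀ s : ℕ,
      Nonempty
        ((LinearMap.ker (adelicCoboundary M K S @hmono (s + 1)) ⧸
            Submodule.comap (LinearMap.ker (adelicCoboundary M K S @hmono (s + 1))).subtype
              (LinearMap.range (adelicCoboundary M K S @hmono s))) ≃ₗ[R]
          (LinearMap.ker (simpCoboundary M K S hdown @hmono (s + 1)) ⧸
            Submodule.comap (LinearMap.ker (simpCoboundary M K S hdown @hmono (s + 1))).subtype
              (LinearMap.range (simpCoboundary M K S hdown @hmono s)))) := by
  exact CellFamily.nonempty_cohomology_equiv (flagFamily K) (simplexFamily K hne hdown)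
    (localizationRestriction K M S @hmono) (adelicCoboundary_eq K M S @hmono)
    (simpCoboundary_eq K M S @hmono hne hdown)
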